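/- Let S⁻(2n;ℝ) = {x ∈ M(2n;ℝ) : xᵀ = −x} be the real vector space of 2n×2n real skew-symmetric matrices with inner product ⟨u,v⟩ = Re Tr(u*v), and let ℂS_n = {x ∈ S⁻(2n;ℝ) : x² = −I_{2n}}, the Grassmannian of complex structures on ℝ^{2n}, regarded as a smooth submanifold of S⁻(2n;ℝ). Let 0 < λ₁ < ⋯ < λ_n, let J be the 2×2 matrix with rows (0,−1) and (1,0), let a = λ₁J ⊕ ⋯ ⊕ λ_nJ, and let f_a : ℂS_n → ℝ, f_a(x) = ‖x − a‖². Then f_a is a Morse function on ℂS_n; its critical points are exactly the matrices σ_I = ε₁J ⊕ ⋯ ⊕ ε_nJ with ε_j = −1 for j ∈ I and ε_j = 1 otherwise, for I = [i₁ < ⋯ < i_r] ⊆ [1,…,n] (including I = ∅); and the index of σ_{i₁,…,i_r} is 2(i₁ + ⋯ + i_r − r). -/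

import Mathlib

open scoped Matrix

attribute [local instance] Matrix.frobeniusNormedAddCommGroup Matrix.frobeniusNormedSpace

/-- The set of tangent vectors to a subset `M ⊆ E` at a point `x`. -/
def TangentSetAt {E : Type*} [NormedAddCommGroup E] [NormedSpace ℝ E]
    (M : Set E) (x : E) : Set E :=
  {u | ∃ c : ℝ → E, ContDiff ℝ (⊤ : ℕ∞) c ∧ (∀ t, c t ∈ M) ∧ c 0 = x ∧ deriv c 0 = u}

/-- `x` is a critical point of the restriction of `f` to `M`. -/
def IsCriticalPointOn {E : Type*} [NormedAddCommGroup E] [NormedSpace ℝ E]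
    (M : Set E) (f : E → ℝ) (x : E) : Prop :=
  x ∈ M ∧ ∀ c : ℝ → E, ContDiff ℝ (⊤ : ℕ∞) c → (∀ t, c t ∈ M) → c 0 = x →
    deriv (f ∘ c) 0 = 0

/-- `B` is the Hessian bilinear form of `f|M` at `x`. -/
def IsHessianAt {E : Type*} [NormedAddCommGroup E] [NormedSpace ℝ E]
    (M : Set E) (f : E → ℝ) (x : E) (B : E →ₗ[ℝ] E →ₗ[ℝ] ℝ) : Prop :=
  ∀ c : ℝ → E, ContDiff ℝ (⊤ : ℕ∞) c → (∀ t, c t ∈ M) → c 0 = x →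
    deriv (deriv (f ∘ c)) 0 = B (deriv c 0) (deriv c 0)

/-- Non-degeneracy of a critical point of `f|M`. -/
def IsNondegenerateCriticalPointOn {E : Type*} [NormedAddCommGroup E] [NormedSpace ℝ E]
    (M : Set E) (f : E → ℝ) (x : E) : Prop :=
  IsCriticalPointOn M f x ∧ ∃ B : E →ₗ[ℝ] E →ₗ[ℝ] ℝ, IsHessianAt M f x B ∧
    ∀ u ∈ TangentSetAt M x, (∀ w ∈ TangentSetAt M x, B u w = 0) → u = 0

/-- `f` is a Morse function on `M`. -/
def IsMorseOn {E : Type*} [NormedAddCommGroup E] [NormedSpace ℝ E]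
    (M : Set E) (f : E → ℝ) : Prop :=
  ∀ x, IsCriticalPointOn M f x → IsNondegenerateCriticalPointOn M f x

/-- The critical point `x` of `f|M` has index `r`. -/
def HasIndexAt {E : Type*} [NormedAddCommGroup E] [NormedSpace ℝ E]
    (M : Set E) (f : E → ℝ) (x : E) (r : ℕ) : Prop :=
  ∃ B : E →ₗ[ℝ] E →ₗ[ℝ] ℝ, IsHessianAt M f x B ∧
    (∃ V : Submodule ℝ E, (V : Set E) ⊆ TangentSetAt M x ∧ Module.finrank ℝ V = r ∧
      ∀ u ∈ V, u ≠ 0 → B u u < 0) ∧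
    (∀ W : Submodule ℝ E, (W : Set E) ⊆ TangentSetAt M x → (∀ u ∈ W, u ≠ 0 → B u u < 0) →
      Module.finrank ℝ W ≤ r)

/-- `ℂS_n = {x ∈ S⁻(2n;ℝ) : x² = −I}`: the Grassmannian of complex structures on `ℝ^{2n}`,
inside the space `S⁻(2n;ℝ)` of real skew-symmetric matrices. -/
def ComplexStructureSet (n : ℕ) : Set (Matrix (Fin (2 * n)) (Fin (2 * n)) ℝ) :=
  {x | xᵀ = -x ∧ x * x = -1}

/-- The block-diagonal matrix `μ₁J ⊕ ⋯ ⊕ μ_nJ`, where `J` is the 2×2 matrix with rows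
`(0,−1)` and `(1,0)`. -/
def blockDiagJ {n : ℕ} (μ : Fin n → ℝ) : Matrix (Fin (2 * n)) (Fin (2 * n)) ℝ :=
  fun i j =>
    if (i : ℕ) / 2 = (j : ℕ) / 2 then
      (if (i : ℕ) % 2 = 0 ∧ (j : ℕ) % 2 = 1 then -μ ⟨(i : ℕ) / 2, by have := i.isLt; omega⟩
       else if (i : ℕ) % 2 = 1 ∧ (j : ℕ) % 2 = 0 then μ ⟨(i : ℕ) / 2, by have := i.isLt; omega⟩
       else 0)
    else 0


section MatrixCalculus

variable {m : Type*} [Fintype m]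

theorem hasDerivAt_matrix_mul [DecidableEq m] {c d : ℝ → Matrix m m ℝ}
    {c' d' : Matrix m m ℝ} {t : ℝ}
    (hc : HasDerivAt c c' t) (hd : HasDerivAt d d' t) :
    HasDerivAt (fun s => c s * d s) (c' * d t + c t * d') t := by
  let _ : NormedRing (Matrix m m ℝ) := Matrix.frobeniusNormedRing
  let _ : NormedAlgebra ℝ (Matrix m m ℝ) := Matrix.frobeniusNormedAlgebra
  exact HasDerivAt.mul (𝔸 := Matrix m m ℝ) hc hd

theorem hasDerivAt_matrix_transpose {c : ℝ → Matrix m m ℝ} {c' : Matrix m m ℝ} {t : ℝ}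
    (hc : HasDerivAt c c' t) : HasDerivAt (fun s => (c s)ᵀ) c'ᵀ t :=
  (LinearMap.toContinuousLinearMap
    (Matrix.transposeLinearEquiv m m ℝ ℝ).toLinearMap).hasFDerivAt.comp_hasDerivAt t hc

theorem hasDerivAt_matrix_trace_mul {c : ℝ → Matrix m m ℝ} {c' : Matrix m m ℝ} {t : ℝ}
    (a : Matrix m m ℝ) (hc : HasDerivAt c c' t) :
    HasDerivAt (fun s => (c s * a).trace) (c' * a).trace t :=
  (LinearMap.toContinuousLinearMap (Matrix.traceLinearMap m ℝ ℝ ∘ₗ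
    LinearMap.mulRight ℝ a)).hasFDerivAt.comp_hasDerivAt t hc

theorem contDiff_matrix_exp_smul_mul [DecidableEq m] (A x : Matrix m m ℝ) :
    ContDiff ℝ (⊤ : ℕ∞) (fun t : ℝ => NormedSpace.exp (t • A) * x) := by
  let _ : NormedRing (Matrix m m ℝ) := Matrix.frobeniusNormedRing
  let _ : NormedAlgebra ℝ (Matrix m m ℝ) := Matrix.frobeniusNormedAlgebra
  have h : ContDiff ℝ (⊤ : ℕ∞) (NormedSpace.exp : Matrix m m ℝ → Matrix m m ℝ) :=
    contDiff_iff_contDiffAt.2 fun y => (NormedSpace.exp_analytic (𝕂 := ℝ) y).contDiffAt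
  have h2 : ContDiff ℝ (⊤ : ℕ∞) (fun t : ℝ => t • A) := contDiff_id.smul contDiff_const
  exact (h.comp h2).mul contDiff_const

theorem hasDerivAt_matrix_exp_smul_mul [DecidableEq m] (A x : Matrix m m ℝ) :
    HasDerivAt (fun t : ℝ => NormedSpace.exp (t • A) * x) (A * x) 0 := by
  let _ : NormedRing (Matrix m m ℝ) := Matrix.frobeniusNormedRing
  let _ : NormedAlgebra ℝ (Matrix m m ℝ) := Matrix.frobeniusNormedAlgebra
  have h := (hasDerivAt_exp_smul_const (𝕂 := ℝ) A (0 : ℝ)).mul_const x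
  simp only [zero_smul, NormedSpace.exp_zero, one_mul] at h
  exact h

theorem frobenius_norm_sq_eq_trace (y : Matrix m m ℝ) : ‖y‖ ^ 2 = (yᵀ * y).trace := by
  rw [Matrix.frobenius_norm_def, ← Real.sqrt_eq_rpow, Real.sq_sqrt (by positivity)]
  simp only [Matrix.trace, Matrix.diag, Matrix.mul_apply, Matrix.transpose_apply]
  rw [Finset.sum_comm]
  simp [sq]

theorem eq_zero_of_trace_transpose_mul_self {y : Matrix m m ℝ} (h : (yᵀ * y).trace = 0) :
    y = 0 := by
  rw [← frobenius_norm_sq_eq_trace] at h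
  exact norm_eq_zero.1 (pow_eq_zero_iff two_ne_zero |>.1 h)

end MatrixCalculus

section ComplexStructures

variable {n : ℕ}

theorem hasDerivAt_of_contDiff {E : Type*} [NormedAddCommGroup E] [NormedSpace ℝ E]
    {c : ℝ → E} (hc : ContDiff ℝ (⊤ : ℕ∞) c) (t : ℝ) : HasDerivAt c (deriv c t) t :=
  (hc.differentiable (by simp) t).hasDerivAt

theorem hasDerivAt_deriv_of_contDiff {E : Type*} [NormedAddCommGroup E] [NormedSpace ℝ E]
    {c : ℝ → E} (hc : ContDiff ℝ (⊤ : ℕ∞) c) (t : ℝ) :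
    HasDerivAt (deriv c) (deriv (deriv c) t) t := by
  have h := contDiff_infty_iff_deriv.1 hc
  exact hasDerivAt_of_contDiff h.2 t

theorem exp_smul_mul_mem_complexStructureSet {x u : Matrix (Fin (2 * n)) (Fin (2 * n)) ℝ}
    (hx : x ∈ ComplexStructureSet n) (hu : uᵀ = -u) (hxu : x * u = -(u * x)) (t : ℝ) :
    NormedSpace.exp (t • (x * u)) * x ∈ ComplexStructureSet n := by
  obtain ⟨hxt, hxx⟩ := hx
  let U : (Matrix (Fin (2 * n)) (Fin (2 * n)) ℝ)ˣ :=
    ⟨x, -x, by rw [mul_neg, hxx, neg_neg], by rw [neg_mul, hxx, neg_neg]⟩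
  set B := t • (x * u) with hB
  have hBt : Bᵀ = -B := by
    rw [hB, Matrix.transpose_smul, Matrix.transpose_mul, hxt, hu, neg_mul_neg, hxu]
    simp
  have hxBx : x * (-B) * (-x) = B := by
    rw [mul_neg, mul_neg, neg_mul, neg_neg, hB, Matrix.mul_smul, Matrix.smul_mul,
      ← mul_assoc, hxx, hxu]
    simp
  have hconj : x * NormedSpace.exp (-B) = NormedSpace.exp B * x := by
    have h := Matrix.exp_units_conj U (-B)
    change NormedSpace.exp (x * (-B) * (-x)) = x * NormedSpace.exp (-B) * (-x) at h
    rw [hxBx] at h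
    rw [h, mul_assoc, neg_mul, hxx, neg_neg, mul_one]
  refine ⟨?_, ?_⟩
  · rw [Matrix.transpose_mul, ← Matrix.exp_transpose, hBt, hxt, neg_mul, hconj]
  · have hinv : NormedSpace.exp B * NormedSpace.exp (-B) = 1 := by
      rw [← Matrix.exp_add_of_commute _ _ (Commute.neg_right (Commute.refl B)), add_neg_cancel,
        NormedSpace.exp_zero]
    calc NormedSpace.exp B * x * (NormedSpace.exp B * x)
        = NormedSpace.exp B * x * (x * NormedSpace.exp (-B)) := by rw [hconj]
      _ = NormedSpace.exp B * (x * x) * NormedSpace.exp (-B) := by simp only [mul_assoc]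
      _ = -1 := by rw [hxx, mul_neg, mul_one, neg_mul, hinv]

theorem mem_tangentSetAt_complexStructureSet {x u : Matrix (Fin (2 * n)) (Fin (2 * n)) ℝ}
    (hx : x ∈ ComplexStructureSet n) :
    u ∈ TangentSetAt (ComplexStructureSet n) x ↔ uᵀ = -u ∧ x * u = -(u * x) := by
  constructor
  · rintro ⟨c, hc, hcM, rfl, rfl⟩
    have h := hasDerivAt_of_contDiff hc 0
    refine ⟨?_, ?_⟩
    · have h1 := hasDerivAt_matrix_transpose h
      rw [funext fun t => (hcM t).1] at h1
      exact h1.unique h.neg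
    · have h1 := hasDerivAt_matrix_mul h h
      rw [funext fun t => (hcM t).2] at h1
      have h2 := h1.unique (hasDerivAt_const (0 : ℝ) _)
      rw [eq_neg_iff_add_eq_zero, add_comm, h2]
  · rintro ⟨hu, hxu⟩
    refine ⟨fun t => NormedSpace.exp (t • (x * u)) * x, contDiff_matrix_exp_smul_mul _ _,
      exp_smul_mul_mem_complexStructureSet hx hu hxu, by simp, ?_⟩
    rw [(hasDerivAt_matrix_exp_smul_mul _ _).deriv, hxu, neg_mul, mul_assoc, hx.2]
    simp

theorem norm_sub_sq_of_mem_complexStructureSet {a y : Matrix (Fin (2 * n)) (Fin (2 * n)) ℝ}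
    (ha : aᵀ = -a) (hy : y ∈ ComplexStructureSet n) :
    ‖y - a‖ ^ 2 = (2 * n - (a * a).trace) + 2 * (y * a).trace := by
  rw [frobenius_norm_sq_eq_trace, Matrix.transpose_sub, ha, hy.1]
  have : (-y - -a) * (y - a) = -(y * y) + y * a + a * y - a * a := by noncomm_ring
  rw [this, hy.2]
  simp only [neg_neg, Matrix.trace_sub, Matrix.trace_add, Matrix.trace_one, Fintype.card_fin,
    Matrix.trace_mul_comm a y]
  push_cast
  ring

theorem hasDerivAt_norm_sub_sq_comp {a : Matrix (Fin (2 * n)) (Fin (2 * n)) ℝ} (ha : aᵀ = -a)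
    {c : ℝ → Matrix (Fin (2 * n)) (Fin (2 * n)) ℝ} (hc : ContDiff ℝ (⊤ : ℕ∞) c)
    (hcM : ∀ t, c t ∈ ComplexStructureSet n) (t : ℝ) :
    HasDerivAt ((fun y => ‖y - a‖ ^ 2) ∘ c) (2 * (deriv c t * a).trace) t := by
  have h : ((fun y => ‖y - a‖ ^ 2) ∘ c) =
      fun t => (2 * n - (a * a).trace) + 2 * (c t * a).trace :=
    funext fun t => norm_sub_sq_of_mem_complexStructureSet ha (hcM t)
  rw [h]
  exact ((hasDerivAt_matrix_trace_mul a (hasDerivAt_of_contDiff hc t)).const_mul 2).const_add _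

theorem isCriticalPointOn_complexStructureSet_iff {a x : Matrix (Fin (2 * n)) (Fin (2 * n)) ℝ}
    (ha : aᵀ = -a) :
    IsCriticalPointOn (ComplexStructureSet n) (fun y => ‖y - a‖ ^ 2) x ↔
      x ∈ ComplexStructureSet n ∧ x * a = a * x := by
  constructor
  · rintro ⟨hx, h⟩
    refine ⟨hx, ?_⟩
    obtain ⟨hxt, hxx⟩ := id hx
    have hx3 (z : Matrix (Fin (2 * n)) (Fin (2 * n)) ℝ) : x * (x * z) = -z := by
      rw [← mul_assoc, hxx, neg_one_mul]
    set u := a + x * a * x with hu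
    have hut : uᵀ = -u := by
      simp only [hu, Matrix.transpose_add, Matrix.transpose_mul, ha, hxt, mul_assoc]
      noncomm_ring
    have hxu : x * u = -(u * x) := by
      simp only [hu, mul_add, add_mul, mul_assoc, hxx, hx3]
      noncomm_ring
    obtain ⟨c, hc, hcM, hc0, hcu⟩ := (mem_tangentSetAt_complexStructureSet hx).2 ⟨hut, hxu⟩
    have h0 := h c hc hcM hc0
    replace hcu : deriv c 0 = u := hcu
    rw [(hasDerivAt_norm_sub_sq_comp ha hc hcM 0).deriv, hcu] at h0
    have h1 : (u * (x * a * x)).trace = (u * a).trace := by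
      rw [mul_assoc x, ← mul_assoc u, Matrix.trace_mul_comm, mul_assoc, ← mul_assoc x, hxu,
        neg_mul, mul_assoc u, hxx, Matrix.trace_mul_comm]
      simp
    have h2 : (uᵀ * u).trace = 0 := by
      rw [hut, neg_mul, Matrix.trace_neg]
      nth_rewrite 2 [hu]
      rw [mul_add, Matrix.trace_add, h1]
      linarith
    have h3 := eq_zero_of_trace_transpose_mul_self h2
    have h4 : x * u = 0 := by rw [h3, mul_zero]
    simp only [hu, mul_add, mul_assoc, hx3] at h4
    exact add_neg_eq_zero.1 h4
  · rintro ⟨hx, hxa⟩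
    refine ⟨hx, fun c hc hcM hc0 => ?_⟩
    rw [(hasDerivAt_norm_sub_sq_comp ha hc hcM 0).deriv]
    have hu : deriv c 0 ∈ TangentSetAt (ComplexStructureSet n) x := ⟨c, hc, hcM, hc0, rfl⟩
    obtain ⟨hut, hxu⟩ := (mem_tangentSetAt_complexStructureSet hx).1 hu
    set u := deriv c 0
    have h1 : (u * a).trace = -(u * a).trace := by
      calc (u * a).trace = -((u * a) * (x * x)).trace := by rw [hx.2]; simp
        _ = -((x * u) * (a * x)).trace := by
            rw [← mul_assoc, Matrix.trace_mul_comm (u * a * x)]; simp only [mul_assoc]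
        _ = (u * (x * x) * a).trace := by
            rw [hxu, ← hxa]; simp [mul_assoc]
        _ = -(u * a).trace := by rw [hx.2]; simp
    linarith

/-- The Hessian form of `y ↦ ‖y - a‖ ^ 2` at a critical point `x`. -/
noncomputable def hessianForm (a x : Matrix (Fin (2 * n)) (Fin (2 * n)) ℝ) :
    Matrix (Fin (2 * n)) (Fin (2 * n)) ℝ →ₗ[ℝ] Matrix (Fin (2 * n)) (Fin (2 * n)) ℝ →ₗ[ℝ] ℝ :=
  LinearMap.mk₂ ℝ (fun u w => 2 * (x * a * u * w).trace)
    (fun _ _ _ => by simp only [mul_add, add_mul, Matrix.trace_add])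
    (fun _ _ _ => by
      simp only [Matrix.mul_smul, Matrix.smul_mul, Matrix.trace_smul, smul_eq_mul]; ring)
    (fun _ _ _ => by simp only [mul_add, Matrix.trace_add])
    (fun _ _ _ => by simp only [Matrix.mul_smul, Matrix.trace_smul, smul_eq_mul]; ring)

theorem two_mul_trace_mul_eq_of_sq_eq_neg_one {m : Type*} [Fintype m] [DecidableEq m]
    {a x u v : Matrix m m ℝ} (hxx : x * x = -1) (hxa : x * a = a * x)
    (h : v * x + u * u + (u * u + x * v) = 0) :
    2 * (v * a).trace = 2 * (x * a * u * u).trace := by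
  have h1 := congrArg (fun z => (x * a * z).trace) h
  simp only [mul_add, Matrix.trace_add, mul_zero, Matrix.trace_zero] at h1
  have h2 : (x * a * (v * x)).trace = -(v * a).trace := by
    rw [← mul_assoc, Matrix.trace_mul_comm, ← mul_assoc, ← mul_assoc, hxx,
      Matrix.trace_mul_comm v]
    simp
  have h3 : (x * a * (x * v)).trace = -(v * a).trace := by
    rw [hxa, mul_assoc, ← mul_assoc x, hxx, Matrix.trace_mul_comm v]
    simp
  rw [h2, h3] at h1
  rw [mul_assoc (x * a)]
  linarith

theorem isHessianAt_hessianForm {a x : Matrix (Fin (2 * n)) (Fin (2 * n)) ℝ} (ha : aᵀ = -a)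
    (hxa : x * a = a * x) :
    IsHessianAt (ComplexStructureSet n) (fun y => ‖y - a‖ ^ 2) x (hessianForm a x) := by
  rintro c hc hcM rfl
  rw [funext fun t => (hasDerivAt_norm_sub_sq_comp ha hc hcM t).deriv]
  refine ((hasDerivAt_matrix_trace_mul a
    (hasDerivAt_deriv_of_contDiff hc 0)).const_mul 2).deriv.trans ?_
  have hd := hasDerivAt_of_contDiff hc
  have hdd := hasDerivAt_deriv_of_contDiff hc 0
  have h1 : (fun t => deriv c t * c t + c t * deriv c t) = fun _ => 0 := by
    funext t
    have h := hasDerivAt_matrix_mul (hd t) (hd t)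
    rw [funext fun t => (hcM t).2] at h
    exact h.unique (hasDerivAt_const t _)
  have h2 := (hasDerivAt_matrix_mul hdd (hd 0)).add (hasDerivAt_matrix_mul (hd 0) hdd)
  have h3 := h2.unique (h1 ▸ hasDerivAt_const (0 : ℝ) _)
  exact two_mul_trace_mul_eq_of_sq_eq_neg_one (hcM 0).2 hxa h3

end ComplexStructures

section Blocks

variable {n : ℕ}

/-- The index of the `2 × 2` block containing the row `p`. -/
def blockIdx (p : Fin (2 * n)) : Fin n := ⟨p / 2, by omega⟩

/-- The other row of the `2 × 2` block containing the row `p`. -/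
def mate (p : Fin (2 * n)) : Fin (2 * n) :=
  ⟨if (p : ℕ) % 2 = 0 then p + 1 else p - 1, by split_ifs <;> omega⟩

/-- The sign of the nonzero entry of `J` in the row `p`. -/
def rowSign (p : Fin (2 * n)) : ℝ := if (p : ℕ) % 2 = 0 then -1 else 1

theorem val_mate (p : Fin (2 * n)) :
    (mate p : ℕ) = if (p : ℕ) % 2 = 0 then (p : ℕ) + 1 else p - 1 := rfl

@[simp] theorem mate_mate (p : Fin (2 * n)) : mate (mate p) = p := by
  ext
  simp only [val_mate]
  split_ifs <;> omega

@[simp] theorem blockIdx_mate (p : Fin (2 * n)) : blockIdx (mate p) = blockIdx p := by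
  simp only [blockIdx, Fin.ext_iff, val_mate]
  split_ifs <;> omega

theorem blockIdx_eq_iff {p q : Fin (2 * n)} : blockIdx p = blockIdx q ↔ q = p ∨ q = mate p := by
  simp only [blockIdx, Fin.ext_iff, val_mate]
  split_ifs <;> omega

@[simp] theorem rowSign_mate (p : Fin (2 * n)) : rowSign (mate p) = -rowSign p := by
  simp only [rowSign, val_mate]
  split_ifs <;> first | omega | norm_num

@[simp] theorem rowSign_mul_self (p : Fin (2 * n)) : rowSign p * rowSign p = 1 := by
  simp only [rowSign]
  split_ifs <;> norm_num

theorem blockDiagJ_apply (μ : Fin n → ℝ) (p q : Fin (2 * n)) :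
    blockDiagJ μ p q = if q = mate p then rowSign p * μ (blockIdx p) else 0 := by
  simp only [blockDiagJ, rowSign, blockIdx, Fin.ext_iff, val_mate]
  split_ifs <;> first | omega | simp

theorem blockDiagJ_mul_apply (μ : Fin n → ℝ) (A : Matrix (Fin (2 * n)) (Fin (2 * n)) ℝ)
    (p q : Fin (2 * n)) :
    (blockDiagJ μ * A) p q = rowSign p * μ (blockIdx p) * A (mate p) q := by
  simp [Matrix.mul_apply, blockDiagJ_apply]

theorem mul_blockDiagJ_apply (μ : Fin n → ℝ) (A : Matrix (Fin (2 * n)) (Fin (2 * n)) ℝ)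
    (p q : Fin (2 * n)) :
    (A * blockDiagJ μ) p q = -(A p (mate q) * (rowSign q * μ (blockIdx q))) := by
  have h (j : Fin (2 * n)) : q = mate j ↔ j = mate q :=
    ⟨fun h => by rw [h, mate_mate], fun h => by rw [h, mate_mate]⟩
  simp [Matrix.mul_apply, blockDiagJ_apply, h]

theorem blockDiagJ_transpose (μ : Fin n → ℝ) : (blockDiagJ μ)ᵀ = -blockDiagJ μ := by
  ext p q
  have h : p = mate q ↔ q = mate p :=
    ⟨fun h => by rw [h, mate_mate], fun h => by rw [h, mate_mate]⟩
  simp only [Matrix.transpose_apply, Matrix.neg_apply, blockDiagJ_apply, h]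
  split_ifs with hq
  · subst hq
    simp
  · simp

theorem blockDiagJ_mul_blockDiagJ (μ ν : Fin n → ℝ) :
    blockDiagJ μ * blockDiagJ ν =
      Matrix.diagonal fun p => -(μ (blockIdx p) * ν (blockIdx p)) := by
  ext p q
  rw [blockDiagJ_mul_apply, blockDiagJ_apply, mate_mate, Matrix.diagonal_apply]
  by_cases h : p = q
  · subst h
    simp only [if_true, rowSign_mate, blockIdx_mate]
    linear_combination -(μ (blockIdx p) * ν (blockIdx p)) * rowSign_mul_self p
  · simp [h, Ne.symm h]

theorem blockDiagJ_mem_complexStructureSet {ε : Fin n → ℝ} (hε : ∀ k, ε k * ε k = 1) :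
    blockDiagJ ε ∈ ComplexStructureSet n :=
  ⟨blockDiagJ_transpose ε, by
    rw [blockDiagJ_mul_blockDiagJ, ← Matrix.diagonal_one, Matrix.diagonal_neg]
    simp [hε]⟩

theorem exists_eq_blockDiagJ_of_commute {l : Fin n → ℝ} (hpos : ∀ i, 0 < l i)
    (hinj : Function.Injective l) {x : Matrix (Fin (2 * n)) (Fin (2 * n)) ℝ}
    (hx : x ∈ ComplexStructureSet n) (hxl : x * blockDiagJ l = blockDiagJ l * x) :
    ∃ ε : Fin n → ℝ, (∀ k, ε k * ε k = 1) ∧ x = blockDiagJ ε := by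
  obtain ⟨hxt, hxx⟩ := hx
  have hskew (p q) : x q p = -x p q := congrFun (congrFun hxt p) q
  have hoff (p q) (hpq : blockIdx p ≠ blockIdx q) : x p q = 0 := by
    have h2 : x * (blockDiagJ l * blockDiagJ l) = (blockDiagJ l * blockDiagJ l) * x := by
      rw [← mul_assoc, hxl, mul_assoc, hxl, mul_assoc]
    rw [blockDiagJ_mul_blockDiagJ] at h2
    have h3 := congrFun (congrFun h2 p) q
    rw [Matrix.mul_diagonal, Matrix.diagonal_mul] at h3
    have h4 :
        (l (blockIdx p) + l (blockIdx q)) * (l (blockIdx p) - l (blockIdx q)) * x p q = 0 := by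
      linear_combination h3
    have h5 := hpos (blockIdx p)
    have h6 := hpos (blockIdx q)
    have h7 : l (blockIdx p) - l (blockIdx q) ≠ 0 := sub_ne_zero.2 fun h => hpq (hinj h)
    simpa [h7, (add_pos h5 h6).ne'] using h4
  have hdiag (p) : x p p = 0 := by linarith [hskew p p]
  have hsupp (p q) (h : q ≠ mate p) : x p q = 0 := by
    by_cases hpq : blockIdx p = blockIdx q
    · obtain rfl | h' := blockIdx_eq_iff.1 hpq
      · exact hdiag _
      · exact absurd h' h
    · exact hoff p q hpq
  let r (k : Fin n) : Fin (2 * n) := ⟨2 * k + 1, by omega⟩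
  have hr (p : Fin (2 * n)) :
      x p (mate p) = rowSign p * x (r (blockIdx p)) (mate (r (blockIdx p))) := by
    have h : r (blockIdx p) = if (p : ℕ) % 2 = 0 then mate p else p := by
      ext
      simp only [r, blockIdx]
      split_ifs with h
      · simp only [val_mate, h, if_true]
        omega
      · omega
    rw [h, rowSign]
    split_ifs
    · rw [mate_mate, hskew p]
      ring
    · ring
  refine ⟨fun k => x (r k) (mate (r k)), fun k => ?_, ?_⟩
  · have h := congrFun (congrFun hxx (r k)) (r k)
    rw [Matrix.mul_apply, Finset.sum_eq_single (mate (r k))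
      (fun j _ hj => by rw [hsupp _ _ hj, zero_mul]) (by simp)] at h
    rw [hskew (r k)] at h
    simp only [Matrix.neg_apply, Matrix.one_apply_eq] at h
    linarith
  · ext p q
    rw [blockDiagJ_apply]
    split_ifs with h
    · rw [h, hr]
    · exact hsupp p q h

theorem hessianForm_blockDiagJ_apply (l ε : Fin n → ℝ)
    {u w : Matrix (Fin (2 * n)) (Fin (2 * n)) ℝ} (hu : uᵀ = -u) (hw : wᵀ = -w) :
    hessianForm (blockDiagJ l) (blockDiagJ ε) u w =
      ∑ p, ∑ q, (ε (blockIdx p) * l (blockIdx p) + ε (blockIdx q) * l (blockIdx q)) *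
        (u p q * w p q) := by
  have hu' (p q) : u q p = -u p q := congrFun (congrFun hu p) q
  have hw' (p q) : w q p = -w p q := congrFun (congrFun hw p) q
  have h1 : hessianForm (blockDiagJ l) (blockDiagJ ε) u w =
      2 * ∑ p, ∑ q, ε (blockIdx p) * l (blockIdx p) * (u p q * w p q) := by
    change 2 * (blockDiagJ ε * blockDiagJ l * u * w).trace = _
    rw [blockDiagJ_mul_blockDiagJ]
    rw [Matrix.trace]
    congr 1
    refine Finset.sum_congr rfl fun p _ => ?_
    rw [Matrix.diag, Matrix.mul_apply]
    refine Finset.sum_congr rfl fun q _ => ?_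
    rw [Matrix.diagonal_mul, hw' p q]
    ring
  have h2 : ∑ p, ∑ q, ε (blockIdx p) * l (blockIdx p) * (u p q * w p q) =
      ∑ p, ∑ q, ε (blockIdx q) * l (blockIdx q) * (u p q * w p q) := by
    rw [Finset.sum_comm]
    refine Finset.sum_congr rfl fun p _ => Finset.sum_congr rfl fun q _ => ?_
    rw [hu' p q, hw' p q]
    ring
  rw [h1, two_mul]
  nth_rewrite 2 [h2]
  simp only [← Finset.sum_add_distrib, ← add_mul]

theorem mul_add_mul_ne_zero {l ε : Fin n → ℝ} (hpos : ∀ i, 0 < l i)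
    (hinj : Function.Injective l) (hε : ∀ k, ε k * ε k = 1) (i k : Fin n) :
    ε i * l i + ε k * l k ≠ 0 := by
  intro h
  have hsq : (l i + l k) * (l i - l k) = 0 := by
    linear_combination (ε i * l i - ε k * l k) * h - l i ^ 2 * hε i + l k ^ 2 * hε k
  rcases mul_eq_zero.1 hsq with h' | h'
  · linarith [hpos i, hpos k]
  · obtain rfl := hinj (sub_eq_zero.1 h')
    have hli := (hpos i).ne'
    have : ε i = 0 := by
      have : 2 * l i * ε i = 0 := by linarith
      simpa [hli] using this
    simpa [this] using hε i

theorem isNondegenerateCriticalPointOn_blockDiagJ {l ε : Fin n → ℝ} (hpos : ∀ i, 0 < l i)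
    (hinj : Function.Injective l) (hε : ∀ k, ε k * ε k = 1)
    (hcrit : IsCriticalPointOn (ComplexStructureSet n) (fun y => ‖y - blockDiagJ l‖ ^ 2)
      (blockDiagJ ε)) :
    IsNondegenerateCriticalPointOn (ComplexStructureSet n) (fun y => ‖y - blockDiagJ l‖ ^ 2)
      (blockDiagJ ε) := by
  have hl := blockDiagJ_transpose l
  have hx := blockDiagJ_mem_complexStructureSet hε
  refine ⟨hcrit, _, isHessianAt_hessianForm hl
    ((isCriticalPointOn_complexStructureSet_iff hl).1 hcrit).2, fun u hu h => ?_⟩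
  obtain ⟨hut, hxu⟩ := (mem_tangentSetAt_complexStructureSet hx).1 hu
  have hu' (p q) : u q p = -u p q := congrFun (congrFun hut p) q
  let d (p : Fin (2 * n)) : ℝ := ε (blockIdx p) * l (blockIdx p)
  let w : Matrix (Fin (2 * n)) (Fin (2 * n)) ℝ := fun p q => (d p + d q) * u p q
  have hwt : wᵀ = -w := by
    ext p q
    change (d q + d p) * u q p = -((d p + d q) * u p q)
    rw [hu']
    ring
  have hxw : blockDiagJ ε * w = -(w * blockDiagJ ε) := by
    ext p q
    have := congrFun (congrFun hxu p) q
    simp only [Matrix.neg_apply, blockDiagJ_mul_apply, mul_blockDiagJ_apply] at this ⊢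
    simp only [w, d, blockIdx_mate]
    linear_combination (d p + d q) * this
  have h0 := h w ((mem_tangentSetAt_complexStructureSet hx).2 ⟨hwt, hxw⟩)
  rw [hessianForm_blockDiagJ_apply l ε hut hwt] at h0
  have hterm (p q) : (d p + d q) * (u p q * w p q) = ((d p + d q) * u p q) ^ 2 := by
    simp only [w]
    ring
  change ∑ p, ∑ q, (d p + d q) * (u p q * w p q) = 0 at h0
  simp only [hterm] at h0
  rw [Finset.sum_eq_zero_iff_of_nonneg fun _ _ => Finset.sum_nonneg fun _ _ => sq_nonneg _] at h0
  ext p q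
  have h1 := h0 p (Finset.mem_univ p)
  rw [Finset.sum_eq_zero_iff_of_nonneg fun _ _ => sq_nonneg _] at h1
  have h2 := h1 q (Finset.mem_univ q)
  simpa [d, mul_add_mul_ne_zero hpos hinj hε] using h2

theorem apply_mate_mate_of_anticommute {ε : Fin n → ℝ} (hε : ∀ k, ε k * ε k = 1)
    {u : Matrix (Fin (2 * n)) (Fin (2 * n)) ℝ}
    (hxu : blockDiagJ ε * u = -(u * blockDiagJ ε)) (p q : Fin (2 * n)) :
    u p q = -(rowSign p * ε (blockIdx p) * u (mate p) (mate q) *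
      (rowSign q * ε (blockIdx q))) := by
  have h := congrFun (congrFun hxu p) (mate q)
  simp only [Matrix.neg_apply, blockDiagJ_mul_apply, mul_blockDiagJ_apply, mate_mate,
    rowSign_mate, blockIdx_mate] at h
  have h1 := hε (blockIdx q)
  have h2 := rowSign_mul_self q
  linear_combination rowSign q * ε (blockIdx q) * h - u p q * rowSign q * rowSign q * h1 -
    u p q * h2

/-- Coordinates on the negative space of the Hessian at `σ_I`: `⟨k, p⟩` stands for the matrix
entry in the row `p` and the first column of the block `k ∈ I`, where `p` lies above that block. -/
abbrev NegIdx (I : Finset (Fin n)) : Type := Σ k : I, Fin (2 * (k : ℕ))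

/-- The row of the matrix entry given by an element of `NegIdx I`. -/
def NegIdx.row {I : Finset (Fin n)} (s : NegIdx I) : Fin (2 * n) :=
  ⟨s.2, by have h1 := s.2.isLt; have h2 := s.1.1.isLt; omega⟩

/-- The column of the matrix entry given by an element of `NegIdx I`. -/
def NegIdx.col {I : Finset (Fin n)} (s : NegIdx I) : Fin (2 * n) :=
  ⟨2 * (s.1 : ℕ), by have h2 := s.1.1.isLt; omega⟩

theorem NegIdx.card_eq (I : Finset (Fin n)) :
    Fintype.card (NegIdx I) = 2 * ((∑ j ∈ I, ((j : ℕ) + 1)) - I.card) := by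
  have h : ∑ j ∈ I, ((j : ℕ) + 1) = ∑ j ∈ I, (j : ℕ) + I.card := by simp [Finset.sum_add_distrib]
  rw [h, Nat.add_sub_cancel, Fintype.card_sigma, Finset.mul_sum]
  simp only [Fintype.card_fin]
  exact Finset.sum_coe_sort I fun k => 2 * (k : ℕ)

theorem NegIdx.ext_row_col {I : Finset (Fin n)} {s t : NegIdx I} (hrow : s.row = t.row)
    (hcol : s.col = t.col) : s = t := by
  obtain ⟨⟨k, hk⟩, p⟩ := s
  obtain ⟨⟨j, hj⟩, q⟩ := t
  simp only [NegIdx.row, NegIdx.col, Fin.ext_iff] at hrow hcol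
  obtain rfl : k = j := Fin.ext (by omega)
  obtain rfl : p = q := Fin.ext hrow
  rfl

theorem NegIdx.blockIdx_col {I : Finset (Fin n)} (s : NegIdx I) : blockIdx s.col = s.1 := by
  ext
  simp only [blockIdx, NegIdx.col]
  omega

theorem NegIdx.blockIdx_row_lt {I : Finset (Fin n)} (s : NegIdx I) :
    blockIdx s.row < blockIdx s.col := by
  have := s.2.isLt
  simp only [blockIdx, NegIdx.col, NegIdx.row, Fin.lt_def]
  omega

theorem NegIdx.exists_row_col {I : Finset (Fin n)} {p q : Fin (2 * n)}
    (hpq : blockIdx p < blockIdx q) (hq : (q : ℕ) % 2 = 0) (hI : blockIdx q ∈ I) :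
    ∃ s : NegIdx I, s.row = p ∧ s.col = q := by
  simp only [blockIdx, Fin.lt_def] at hpq
  refine ⟨⟨⟨blockIdx q, hI⟩, ⟨p, by simp only [blockIdx]; omega⟩⟩, rfl, ?_⟩
  ext
  simp only [NegIdx.col, blockIdx]
  omega

theorem NegIdx.even_col {I : Finset (Fin n)} (s : NegIdx I) : (s.col : ℕ) % 2 = 0 := by
  simp only [NegIdx.col]
  omega

/-- The signs `ε_j` of the critical point `σ_I`. -/
abbrev critSign (I : Finset (Fin n)) (j : Fin n) : ℝ := if j ∈ I then -1 else 1

theorem critSign_mul_self (I : Finset (Fin n)) (k : Fin n) : critSign I k * critSign I k = 1 := by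
  unfold critSign
  split_ifs <;> norm_num

theorem critSign_mul_add_neg_iff {l : Fin n → ℝ} (hpos : ∀ i, 0 < l i) (hmono : StrictMono l)
    (I : Finset (Fin n)) {i k : Fin n} (hik : i < k) :
    critSign I i * l i + critSign I k * l k < 0 ↔ k ∈ I := by
  have h1 := hmono hik
  have h2 := hpos i
  unfold critSign
  split_ifs with h3 h4 h4 <;> simp only [h4, iff_true, iff_false] <;> linarith

/-- The matrix with the given entries at the positions listed by `NegIdx I`, and zero elsewhere. -/
noncomputable def negMatrix (I : Finset (Fin n)) :
    (NegIdx I → ℝ) →ₗ[ℝ] Matrix (Fin (2 * n)) (Fin (2 * n)) ℝ :=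
  Fintype.linearCombination ℝ fun s : NegIdx I => Matrix.single s.row s.col (1 : ℝ)

theorem negMatrix_apply (I : Finset (Fin n)) (g : NegIdx I → ℝ) (p q : Fin (2 * n)) :
    negMatrix I g p q = ∑ s, if s.row = p ∧ s.col = q then g s else 0 := by
  rw [negMatrix, Fintype.linearCombination_apply, Matrix.sum_apply]
  refine Finset.sum_congr rfl fun s _ => ?_
  simp [Matrix.single_apply]

theorem negMatrix_row_col (I : Finset (Fin n)) (g : NegIdx I → ℝ) (s : NegIdx I) :
    negMatrix I g s.row s.col = g s := by
  rw [negMatrix_apply, Finset.sum_eq_single s]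
  · simp
  · intro t _ hts
    exact if_neg fun h => hts (NegIdx.ext_row_col h.1 h.2)
  · simp

theorem negMatrix_eq_zero {I : Finset (Fin n)} (g : NegIdx I → ℝ) {p q : Fin (2 * n)}
    (h : ∀ s : NegIdx I, s.row = p → s.col ≠ q) : negMatrix I g p q = 0 := by
  rw [negMatrix_apply]
  exact Finset.sum_eq_zero fun s _ => if_neg fun hs => h s hs.1 hs.2

/-- The parametrization of the negative space of the Hessian at `σ_I`. -/
noncomputable def negParam (I : Finset (Fin n)) :
    (NegIdx I → ℝ) →ₗ[ℝ] Matrix (Fin (2 * n)) (Fin (2 * n)) ℝ :=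
  (LinearMap.id + LinearMap.mulLeft ℝ (blockDiagJ (critSign I)) ∘ₗ
      LinearMap.mulRight ℝ (blockDiagJ (critSign I))) ∘ₗ
    (LinearMap.id - (Matrix.transposeLinearEquiv (Fin (2 * n)) (Fin (2 * n)) ℝ ℝ).toLinearMap) ∘ₗ
      negMatrix I

theorem negParam_eq (I : Finset (Fin n)) (g : NegIdx I → ℝ) :
    negParam I g = (negMatrix I g - (negMatrix I g)ᵀ) +
      blockDiagJ (critSign I) * ((negMatrix I g - (negMatrix I g)ᵀ) * blockDiagJ (critSign I)) :=
  rfl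

theorem negParam_apply (I : Finset (Fin n)) (g : NegIdx I → ℝ) (p q : Fin (2 * n)) :
    negParam I g p q = negMatrix I g p q - negMatrix I g q p -
      rowSign p * critSign I (blockIdx p) * (rowSign q * critSign I (blockIdx q)) *
        (negMatrix I g (mate p) (mate q) - negMatrix I g (mate q) (mate p)) := by
  rw [negParam_eq, Matrix.add_apply, blockDiagJ_mul_apply, mul_blockDiagJ_apply]
  simp only [Matrix.sub_apply, Matrix.transpose_apply]
  ring

theorem negParam_mem_tangentSetAt (I : Finset (Fin n)) (g : NegIdx I → ℝ) :
    negParam I g ∈ TangentSetAt (ComplexStructureSet n) (blockDiagJ (critSign I)) := by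
  have hx := blockDiagJ_mem_complexStructureSet (critSign_mul_self I)
  rw [mem_tangentSetAt_complexStructureSet hx, negParam_eq]
  obtain ⟨hxt, hxx⟩ := hx
  generalize negMatrix I g = e
  generalize blockDiagJ (critSign I) = x at hxt hxx
  constructor
  · simp only [Matrix.transpose_add, Matrix.transpose_sub, Matrix.transpose_mul,
      Matrix.transpose_transpose, hxt]
    noncomm_ring
  · have h1 : x * (x * ((e - eᵀ) * x)) = -((e - eᵀ) * x) := by
      rw [← mul_assoc, hxx, neg_one_mul]
    rw [mul_add, h1, add_mul, mul_assoc x, mul_assoc (e - eᵀ), hxx]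
    noncomm_ring

theorem negParam_row_col (I : Finset (Fin n)) (g : NegIdx I → ℝ) (s : NegIdx I) :
    negParam I g s.row s.col = g s := by
  have hlt := s.blockIdx_row_lt
  have h1 : negMatrix I g s.col s.row = 0 := negMatrix_eq_zero g fun t h2 h3 => by
    have := t.blockIdx_row_lt
    rw [h2, h3] at this
    exact this.not_gt hlt
  have h2 : negMatrix I g (mate s.row) (mate s.col) = 0 := negMatrix_eq_zero g fun t _ h3 => by
    have h4 := t.even_col
    rw [h3, val_mate, if_pos s.even_col] at h4
    have := s.even_col
    omega
  have h3 : negMatrix I g (mate s.col) (mate s.row) = 0 := negMatrix_eq_zero g fun t h2 h3 => by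
    have := t.blockIdx_row_lt
    rw [h2, h3, blockIdx_mate, blockIdx_mate] at this
    exact this.not_gt hlt
  rw [negParam_apply, negMatrix_row_col, h1, h2, h3]
  ring

theorem negParam_injective (I : Finset (Fin n)) : Function.Injective (negParam I) := by
  intro g g' h
  funext s
  rw [← negParam_row_col I g s, h, negParam_row_col]

theorem negParam_eq_zero {l : Fin n → ℝ} (hpos : ∀ i, 0 < l i) (hmono : StrictMono l)
    (I : Finset (Fin n)) (g : NegIdx I → ℝ) {p q : Fin (2 * n)}
    (h : 0 ≤ critSign I (blockIdx p) * l (blockIdx p) + critSign I (blockIdx q) * l (blockIdx q)) :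
    negParam I g p q = 0 := by
  have key (p' q' : Fin (2 * n)) (h' : 0 ≤ critSign I (blockIdx p') * l (blockIdx p') +
      critSign I (blockIdx q') * l (blockIdx q')) : negMatrix I g p' q' = 0 := by
    refine negMatrix_eq_zero g fun s hp hq => h'.not_gt ?_
    subst hp hq
    refine (critSign_mul_add_neg_iff hpos hmono I s.blockIdx_row_lt).2 ?_
    rw [s.blockIdx_col]
    exact s.1.2
  have h' := h
  rw [add_comm] at h'
  rw [negParam_apply, key p q h, key q p h', key (mate p) (mate q) (by simpa using h),
    key (mate q) (mate p) (by simpa using h')]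
  ring

theorem eq_zero_of_coords_eq_zero {l : Fin n → ℝ} (hpos : ∀ i, 0 < l i) (hmono : StrictMono l)
    (I : Finset (Fin n)) {u : Matrix (Fin (2 * n)) (Fin (2 * n)) ℝ}
    (hu : u ∈ TangentSetAt (ComplexStructureSet n) (blockDiagJ (critSign I)))
    (h0 : ∀ s : NegIdx I, u s.row s.col = 0) {p q : Fin (2 * n)}
    (h : critSign I (blockIdx p) * l (blockIdx p) + critSign I (blockIdx q) * l (blockIdx q) < 0) :
    u p q = 0 := by
  have hε := critSign_mul_self I
  obtain ⟨hut, hxu⟩ :=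
    (mem_tangentSetAt_complexStructureSet (blockDiagJ_mem_complexStructureSet hε)).1 hu
  have hu' (p q) : u q p = -u p q := congrFun (congrFun hut p) q
  have hmate := apply_mate_mate_of_anticommute hε hxu
  have hlt (p q : Fin (2 * n)) (hpq : blockIdx p < blockIdx q)
      (h : critSign I (blockIdx p) * l (blockIdx p) +
        critSign I (blockIdx q) * l (blockIdx q) < 0) : u p q = 0 := by
    have hI := (critSign_mul_add_neg_iff hpos hmono I hpq).1 h
    by_cases hq : (q : ℕ) % 2 = 0
    · obtain ⟨s, rfl, rfl⟩ := NegIdx.exists_row_col hpq hq hI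
      exact h0 s
    · have hq' : (mate q : ℕ) % 2 = 0 := by
        rw [val_mate, if_neg hq]
        omega
      obtain ⟨s, hs1, hs2⟩ := NegIdx.exists_row_col (I := I) (p := mate p) (q := mate q)
        (by simpa using hpq) hq' (by simpa using hI)
      rw [hmate, ← hs1, ← hs2, h0]
      ring
  rcases lt_trichotomy (blockIdx p) (blockIdx q) with hpq | hpq | hpq
  · exact hlt p q hpq h
  · obtain rfl | rfl := blockIdx_eq_iff.1 hpq
    · linarith [hu' q q]
    · have h1 := hmate p (mate p)
      simp only [mate_mate, rowSign_mate, blockIdx_mate] at h1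
      have h2 : rowSign p * critSign I (blockIdx p) * u (mate p) p *
          (-rowSign p * critSign I (blockIdx p)) = -u (mate p) p := by
        linear_combination (-u (mate p) p) * rowSign p * rowSign p * hε (blockIdx p) -
          u (mate p) p * rowSign_mul_self p
      linarith [hu' p (mate p)]
  · rw [hu' q p, hlt q p hpq (by rwa [add_comm]), neg_zero]

theorem hasIndexAt_blockDiagJ {l : Fin n → ℝ} (hpos : ∀ i, 0 < l i) (hmono : StrictMono l)
    (I : Finset (Fin n)) :
    HasIndexAt (ComplexStructureSet n) (fun y => ‖y - blockDiagJ l‖ ^ 2)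
      (blockDiagJ (critSign I)) (Fintype.card (NegIdx I)) := by
  have hx := blockDiagJ_mem_complexStructureSet (critSign_mul_self I)
  have hcomm : blockDiagJ (critSign I) * blockDiagJ l = blockDiagJ l * blockDiagJ (critSign I) := by
    simp only [blockDiagJ_mul_blockDiagJ, mul_comm]
  refine ⟨_, isHessianAt_hessianForm (blockDiagJ_transpose l) hcomm,
    ⟨LinearMap.range (negParam I), ?_, ?_, ?_⟩, fun W hW hneg => ?_⟩
  · rintro _ ⟨g, rfl⟩
    exact negParam_mem_tangentSetAt I g
  · rw [LinearMap.finrank_range_of_inj (negParam_injective I), Module.finrank_fintype_fun_eq_card]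
  · rintro _ ⟨g, rfl⟩ hne
    have hu := ((mem_tangentSetAt_complexStructureSet hx).1 (negParam_mem_tangentSetAt I g)).1
    rw [hessianForm_blockDiagJ_apply l _ hu hu]
    have hterm (p q) : (critSign I (blockIdx p) * l (blockIdx p) +
        critSign I (blockIdx q) * l (blockIdx q)) *
          (negParam I g p q * negParam I g p q) ≤ 0 := by
      rcases le_or_gt 0 (critSign I (blockIdx p) * l (blockIdx p) +
        critSign I (blockIdx q) * l (blockIdx q)) with h | h
      · rw [negParam_eq_zero hpos hmono I g h]
        simp
      · exact mul_nonpos_of_nonpos_of_nonneg h.le (mul_self_nonneg _)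
    obtain ⟨p, q, hpq⟩ : ∃ p q, negParam I g p q ≠ 0 := by
      by_contra! h
      exact hne (Matrix.ext h)
    refine Finset.sum_neg' (fun p _ => Finset.sum_nonpos fun q _ => hterm p q)
      ⟨p, Finset.mem_univ p, Finset.sum_neg' (fun q _ => hterm p q) ⟨q, Finset.mem_univ q, ?_⟩⟩
    refine mul_neg_of_neg_of_pos ?_ (mul_self_pos.2 hpq)
    by_contra! h
    exact hpq (negParam_eq_zero hpos hmono I g h)
  · let R : W →ₗ[ℝ] (NegIdx I → ℝ) :=
      LinearMap.pi fun s => Matrix.entryLinearMap ℝ ℝ s.row s.col ∘ₗ W.subtype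
    have hR : Function.Injective R := by
      rw [← LinearMap.ker_eq_bot, LinearMap.ker_eq_bot']
      rintro ⟨u, huW⟩ hu0
      have h0 (s : NegIdx I) : u s.row s.col = 0 := congrFun hu0 s
      by_contra hne
      have hlt := hneg u huW fun h => hne (Subtype.ext h)
      have hu := ((mem_tangentSetAt_complexStructureSet hx).1 (hW huW)).1
      rw [hessianForm_blockDiagJ_apply l _ hu hu] at hlt
      refine hlt.not_ge (Finset.sum_nonneg fun p _ => Finset.sum_nonneg fun q _ => ?_)
      rcases le_or_gt 0 (critSign I (blockIdx p) * l (blockIdx p) +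
        critSign I (blockIdx q) * l (blockIdx q)) with h | h
      · exact mul_nonneg h (mul_self_nonneg _)
      · rw [eq_zero_of_coords_eq_zero hpos hmono I (hW huW) h0 h]
        simp
    simpa using LinearMap.finrank_le_finrank_of_injective hR

end Blocks

/-- For `0 < λ₁ < ⋯ < λ_n` and `a = λ₁J ⊕ ⋯ ⊕ λ_nJ`, the function
`f_a(x) = ‖x − a‖²` is a Morse function on `ℂS_n`; its critical points are exactly the
`σ_I = ε₁J ⊕ ⋯ ⊕ ε_nJ` with `ε_j = −1` for `j ∈ I` and `1` otherwise; and the index of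
`σ_{i₁,…,i_r}` is `2(i₁ + ⋯ + i_r − r)`. -/
theorem complexStructures_distSq_isMorse (n : ℕ) (l : Fin n → ℝ)
    (hpos : ∀ i, 0 < l i) (hmono : StrictMono l) :
    IsMorseOn (ComplexStructureSet n) (fun y => ‖y - blockDiagJ l‖ ^ 2) ∧
    {x | IsCriticalPointOn (ComplexStructureSet n) (fun y => ‖y - blockDiagJ l‖ ^ 2) x} =
      {x | ∃ I : Finset (Fin n),
        x = blockDiagJ (fun j => if j ∈ I then (-1 : ℝ) else 1)} ∧
    ∀ I : Finset (Fin n),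
      HasIndexAt (ComplexStructureSet n) (fun y => ‖y - blockDiagJ l‖ ^ 2)
        (blockDiagJ (fun j => if j ∈ I then (-1 : ℝ) else 1))
        (2 * ((∑ j ∈ I, ((j : ℕ) + 1)) - I.card)) := by
  have hl := blockDiagJ_transpose l
  refine ⟨fun x hx => ?_, ?_, fun I => ?_⟩
  · obtain ⟨hxM, hxl⟩ := (isCriticalPointOn_complexStructureSet_iff hl).1 hx
    obtain ⟨ε, hε, rfl⟩ := exists_eq_blockDiagJ_of_commute hpos hmono.injective hxM hxl
    exact isNondegenerateCriticalPointOn_blockDiagJ hpos hmono.injective hε hx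
  · ext x
    rw [Set.mem_ofPred_eq, Set.mem_ofPred_eq, isCriticalPointOn_complexStructureSet_iff hl]
    constructor
    · rintro ⟨hxM, hxl⟩
      obtain ⟨ε, hε, rfl⟩ := exists_eq_blockDiagJ_of_commute hpos hmono.injective hxM hxl
      refine ⟨Finset.univ.filter fun j => ε j = -1, congrArg blockDiagJ (funext fun j => ?_)⟩
      rcases mul_self_eq_one_iff.1 (hε j) with h | h
      · norm_num [h]
      · simp [h]
    · rintro ⟨I, rfl⟩
      exact ⟨blockDiagJ_mem_complexStructureSet (critSign_mul_self I), by
        simp only [blockDiagJ_mul_blockDiagJ, mul_comm]⟩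
  · rw [← NegIdx.card_eq]
    exact hasIndexAt_blockDiagJ hpos hmono I
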